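/- Let Z̃_m = Σ_{n=1}^∞ n φ_{n,m} (2/27)^n. Then for every real t > 0, lim_{m→∞} (1/Z̃_m) Σ_{n > t m²} n φ_{n,m} (2/27)^n = (1/√(3π)) ∫_t^∞ x^{−3/2} e^{−1/(3x)} dx. (Equivalently: with respect to the free marked triangulation distribution μ̃_m, the rescaled size m^{−2}|T| converges in distribution to (2/3)·S_{1/2}, a completely asymmetric stable random variable of type 1/2.) -/

import Mathlib

open Filter MeasureTheory

/-- `φ_{n,m}`: the number of rooted type II triangulations of a disc with `m+2`
boundary vertices and `n` internal vertices. -/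
noncomputable def phi (n m : ℕ) : ℝ :=
  2 ^ (n + 1) * ((2 * m + 1).factorial : ℝ) * ((2 * m + 3 * n).factorial : ℝ) /
    (((m.factorial : ℝ)) ^ 2 * ((n.factorial : ℝ)) * (((2 * m + 2 * n + 2).factorial : ℝ)))

/-- `Z̃_m = Σ_n n φ_{n,m} (2/27)^n`, the partition function of free marked
triangulations of an `(m+2)`-gon. -/
noncomputable def Ztilde (m : ℕ) : ℝ := ∑' n : ℕ, (n : ℝ) * phi n m * (2 / 27) ^ n

open scoped Topology

/-- The product comparing `(3n+k)!/(2n+k)!` with `(3/2)^k (3n)!/(2n)!`. -/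
noncomputable def PP (n k : ℕ) : ℝ :=
  ∏ j ∈ Finset.range k, ((6 * n + 2 * (j + 1) : ℝ) / (6 * n + 3 * (j + 1)))

noncomputable def BB (n : ℕ) : ℝ :=
  ((3 * n).factorial : ℝ) / ((n.factorial : ℝ) * ((2 * n).factorial : ℝ)) * (4 / 27) ^ n

noncomputable def GG (n m : ℕ) : ℝ :=
  (n : ℝ) / ((2 * n + 2 * m + 1) * (2 * n + 2 * m + 2)) * BB n * PP n (2 * m)

noncomputable def AA (m : ℕ) : ℝ :=
  2 * ((2 * m + 1).factorial : ℝ) / (m.factorial : ℝ) ^ 2 * (9 / 4) ^ m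

lemma AA_pos (m : ℕ) : 0 < AA m := by
  unfold AA; positivity

lemma PP_nonneg (n k : ℕ) : 0 ≤ PP n k := by
  unfold PP; positivity

lemma BB_nonneg (n : ℕ) : 0 ≤ BB n := by
  unfold BB; positivity

lemma GG_nonneg (n m : ℕ) : 0 ≤ GG n m := by
  have := PP_nonneg n (2 * m)
  have := BB_nonneg n
  unfold GG; positivity

lemma fact_ratio (n k : ℕ) :
    ((3 * n + k).factorial : ℝ) * ((2 * n).factorial : ℝ) =
      ((2 * n + k).factorial : ℝ) * ((3 * n).factorial : ℝ) * (3 / 2) ^ k * PP n k := by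
  induction k with
  | zero => simp [PP]; ring
  | succ k ih =>
    have h1 : PP n (k + 1) = PP n k * ((6 * n + 2 * (k + 1) : ℝ) / (6 * n + 3 * (k + 1))) := by
      unfold PP; rw [Finset.prod_range_succ]
    rw [h1, ← add_assoc, ← add_assoc, Nat.factorial_succ, Nat.factorial_succ]
    push_cast
    have h2 : (6 * n + 3 * (k + 1) : ℝ) ≠ 0 := by positivity
    rw [mul_assoc, ih]
    field_simp
    ring

lemma term_eq (n m : ℕ) : (n : ℝ) * phi n m * (2 / 27) ^ n = AA m * GG n m := by
  have h := fact_ratio n (2 * m)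
  have e1 : (2 * m + 3 * n) = 3 * n + 2 * m := by ring
  have e2 : (2 * m + 2 * n + 2) = (2 * n + 2 * m) + 1 + 1 := by ring
  unfold phi AA GG BB
  rw [e1, e2, Nat.factorial_succ (2 * n + 2 * m + 1), Nat.factorial_succ (2 * n + 2 * m)]
  push_cast
  have h3 : ((3 * n + 2 * m).factorial : ℝ) = 
     ((2 * n + 2 * m).factorial : ℝ) * ((3 * n).factorial : ℝ) * (9 / 4) ^ m * PP n (2 * m)
       / ((2 * n).factorial : ℝ) := by
    rw [eq_div_iff (by positivity), h, pow_mul]; norm_num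
  rw [h3]
  have h4 : (2 : ℝ) ^ (n + 1) * (2 / 27) ^ n = 2 * (4 / 27) ^ n := by
    rw [pow_succ, mul_right_comm, ← mul_pow]; norm_num; ring
  have hm : (m.factorial : ℝ) ≠ 0 := by positivity
  have hn : (n.factorial : ℝ) ≠ 0 := by positivity
  have hn2 : ((2 * n).factorial : ℝ) ≠ 0 := by positivity
  have hnm : ((2 * n + 2 * m).factorial : ℝ) ≠ 0 := by positivity
  have hd1 : (2 * n + 2 * m + 1 : ℝ) ≠ 0 := by positivity
  have hd2 : (2 * n + 2 * m + 2 : ℝ) ≠ 0 := by positivity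
  have hd3 : (2 * n + 2 * m + 1 + 1 : ℝ) ≠ 0 := by positivity
  have e3 : (2 * n + 2 * m + 1 + 1 : ℝ) = 2 * n + 2 * m + 2 := by ring
  rw [e3]
  generalize PP n (2 * m) = P
  have : ∀ X Y : ℝ, X * (2 : ℝ) ^ (n + 1) * Y * (2 / 27) ^ n = X * Y * (2 * (4 / 27) ^ n) := by
    intro X Y; rw [← h4]; ring
  rw [show ∀ a b c d e f : ℝ, a * (b * c * d / e) * f = (a * b * (c * d / e) * f) by
    intros; ring, this]
  generalize ((4 : ℝ) / 27) ^ n = u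
  generalize ((9 : ℝ) / 4) ^ m = v
  field_simp

lemma sum_j (m : ℕ) : ∑ j ∈ Finset.range (2 * m), ((j : ℝ) + 1) = m * (2 * m + 1) := by
  induction m with
  | zero => simp
  | succ m ih =>
    rw [show 2 * (m + 1) = 2 * m + 1 + 1 by ring, Finset.sum_range_succ, Finset.sum_range_succ, ih]
    push_cast; ring

lemma PP_le (n m : ℕ) (hn : 1 ≤ n) :
    PP n (2 * m) ≤ Real.exp (-((m : ℝ) * (2 * m + 1) / (6 * (n + m)))) := by
  have hn' : (0 : ℝ) < n := by exact_mod_cast hn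
  rw [← sum_j, Finset.sum_div, ← Finset.sum_neg_distrib, Real.exp_sum]
  unfold PP
  refine Finset.prod_le_prod (fun i _ => by positivity) (fun j hj => ?_)
  have hj' : (j : ℝ) + 1 ≤ 2 * m := by
    have := Finset.mem_range.1 hj
    exact_mod_cast this
  have h1 := Real.add_one_le_exp (-(((j : ℝ) + 1) / (6 * (n + m))))
  refine le_trans ?_ h1
  have h2 : (6 * n + 2 * (j + 1) : ℝ) / (6 * n + 3 * (j + 1)) =
      -(((j : ℝ) + 1) / (6 * n + 3 * (j + 1))) + 1 := by
    field_simp; ring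
  rw [h2]
  gcongr
  linarith

lemma le_PP (n m : ℕ) (hn : 1 ≤ n) :
    Real.exp (-((m : ℝ) * (2 * m + 1) / (6 * n))) ≤ PP n (2 * m) := by
  have hn' : (0 : ℝ) < n := by exact_mod_cast hn
  rw [← sum_j, Finset.sum_div, ← Finset.sum_neg_distrib, Real.exp_sum]
  unfold PP
  refine Finset.prod_le_prod (fun i _ => by positivity) (fun j hj => ?_)
  have h1 := Real.add_one_le_exp ((((j : ℝ) + 1) / (6 * n)))
  rw [Real.exp_neg, inv_le_comm₀ (by positivity) (by positivity)]
  refine le_trans ?_ h1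
  rw [inv_div]
  have h2 : (6 * n + 3 * (j + 1) : ℝ) / (6 * n + 2 * (j + 1)) =
      (((j : ℝ) + 1) / (6 * n + 2 * (j + 1))) + 1 := by
    field_simp; ring
  rw [h2]
  gcongr
  have : (0 : ℝ) ≤ j := by positivity
  linarith

lemma BB_stirling (n : ℕ) (hn : 1 ≤ n) : Real.sqrt n * BB n =
    Stirling.stirlingSeq (3 * n) / (Stirling.stirlingSeq n * Stirling.stirlingSeq (2 * n))
      * (Real.sqrt 3 / 2) := by
  have hn' : (0 : ℝ) < n := by exact_mod_cast hn
  unfold BB Stirling.stirlingSeq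
  push_cast
  rw [show (2 * (3 * n) : ℝ) = 3 * (2 * n) by ring, Real.sqrt_mul (by norm_num) (2 * n : ℝ),
    show (2 * (2 * n) : ℝ) = 2 ^ 2 * n by ring, Real.sqrt_mul (by norm_num : (0:ℝ) ≤ 2 ^ 2) (n : ℝ),
    Real.sqrt_sq (by norm_num)]
  have e1 : (3 * (n : ℝ) / Real.exp 1) ^ (3 * n) = 27 ^ n * ((n / Real.exp 1) ^ n) ^ 3 := by
    rw [mul_div_assoc, mul_pow, pow_mul, pow_mul' _ 3 n]
    norm_num
  have e2 : (2 * (n : ℝ) / Real.exp 1) ^ (2 * n) = 4 ^ n * ((n / Real.exp 1) ^ n) ^ 2 := by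
    rw [mul_div_assoc, mul_pow, pow_mul, pow_mul' _ 2 n]
    norm_num
  rw [e1, e2, div_pow]
  have : 0 < (n / Real.exp 1) ^ n := by positivity
  generalize (n / Real.exp 1) ^ n = w at *
  have h3 : Real.sqrt 3 ^ 2 = 3 := Real.sq_sqrt (by norm_num)
  have h3' : 0 < Real.sqrt 3 := by positivity
  have hsn : 0 < Real.sqrt n := by positivity
  have hs2n : 0 < Real.sqrt (2 * n) := by positivity
  field_simp
  try rw [h3]
  try ring

lemma BB_tendsto : ∃ c : ℝ, 0 < c ∧ Tendsto (fun n : ℕ => Real.sqrt n * BB n) atTop (𝓝 c) := by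
  have hs := Stirling.tendsto_stirlingSeq_sqrt_pi
  have hpi : 0 < Real.sqrt Real.pi := Real.sqrt_pos.2 Real.pi_pos
  refine ⟨Real.sqrt Real.pi / (Real.sqrt Real.pi * Real.sqrt Real.pi) * (Real.sqrt 3 / 2),
    by positivity, ?_⟩
  have h3 : Tendsto (fun n : ℕ => 3 * n) atTop atTop :=
    tendsto_id.const_mul_atTop' (by norm_num)
  have h2 : Tendsto (fun n : ℕ => 2 * n) atTop atTop :=
    tendsto_id.const_mul_atTop' (by norm_num)
  have := ((hs.comp h3).div (hs.mul (hs.comp h2)) (by positivity)).mul_const (Real.sqrt 3 / 2)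
  refine this.congr' ?_
  filter_upwards [eventually_ge_atTop 1] with n hn
  rw [BB_stirling n hn]; rfl

lemma q_rpow (n m : ℕ) (hn : 1 ≤ n) (hm : 1 ≤ m) :
    ((n : ℝ) / m ^ 2) ^ (-(3 : ℝ) / 2) = m ^ 3 / (n * Real.sqrt n) := by
  have hn' : (0 : ℝ) < n := by exact_mod_cast hn
  have hm' : (0 : ℝ) < m := by exact_mod_cast hm
  have hq : (0 : ℝ) < n / m ^ 2 := by positivity
  rw [show -(3 : ℝ) / 2 = -(1 + 1 / 2) by norm_num, Real.rpow_neg hq.le, Real.rpow_add hq,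
    Real.rpow_one, ← Real.sqrt_eq_rpow, Real.sqrt_div hn'.le, Real.sqrt_sq hm'.le]
  have : 0 < Real.sqrt n := by positivity
  field_simp

/-- exact factorisation -/
lemma GG_eq (n m : ℕ) (hn : 1 ≤ n) (hm : 1 ≤ m) :
    (m : ℝ) ^ 3 * GG n m = ((n : ℝ) / m ^ 2) ^ (-(3 : ℝ) / 2) *
      ((n : ℝ) ^ 2 / ((2 * n + 2 * m + 1) * (2 * n + 2 * m + 2))) * (Real.sqrt n * BB n) *
        PP n (2 * m) := by
  have hn' : (0 : ℝ) < n := by exact_mod_cast hn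
  rw [q_rpow n m hn hm]
  unfold GG
  have : 0 < Real.sqrt n := by positivity
  field_simp

lemma crude (n m : ℕ) (hn : 1 ≤ n) (hm : 1 ≤ m) :
    (m : ℝ) ^ 3 / (n * Real.sqrt n) * Real.exp (-((m : ℝ) * (2 * m + 1) / (6 * (n + m)))) ≤ 1296 := by
  have hn' : (1 : ℝ) ≤ n := by exact_mod_cast hn
  have hm' : (1 : ℝ) ≤ m := by exact_mod_cast hm
  have hs : (1 : ℝ) ≤ Real.sqrt n := Real.one_le_sqrt.2 hn'
  rcases le_total (m : ℝ) n with h | h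
  · set s := Real.sqrt n with hsdef
    have hss : (n : ℝ) = s ^ 2 := (Real.sq_sqrt (by positivity)).symm
    have hz : ((m / s) ^ 2) / 6 ≤ (m : ℝ) * (2 * m + 1) / (6 * (n + m)) := by
      rw [div_pow, ← hss, div_div, div_le_div_iff₀ (by positivity) (by positivity)]
      nlinarith [mul_nonneg (sq_nonneg (m : ℝ)) (sub_nonneg.2 h), mul_pos (show (0:ℝ) < m by linarith) (show (0:ℝ) < n by linarith)]
    have h1 : (m : ℝ) ^ 3 / (n * s) = (m / s) ^ 3 := by rw [hss]; field_simp
    rw [h1]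
    have hv : 0 ≤ (m : ℝ) / s := by positivity
    generalize (m : ℝ) / s = v at *
    have h2 := Real.pow_div_factorial_le_exp (x := v ^ 2 / 6) (by positivity) 2
    have h4 : 1 ≤ Real.exp (v ^ 2 / 6) := Real.one_le_exp (by positivity)
    have h3 : Real.exp (v ^ 2 / 6) ≤ Real.exp ((m : ℝ) * (2 * m + 1) / (6 * (n + m))) :=
      Real.exp_le_exp.2 hz
    rw [Real.exp_neg, ← div_eq_mul_inv, div_le_iff₀ (Real.exp_pos _)]
    norm_num [Nat.factorial] at h2
    have h5 : v ^ 3 ≤ 1 + v ^ 4 := by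
      nlinarith [sq_nonneg (v ^ 2 - v), sq_nonneg (v - 1), sq_nonneg (v ^ 2 - 1), sq_nonneg (v ^ 2), sq_nonneg v]
    nlinarith
  · have hz : (m : ℝ) / 6 ≤ (m : ℝ) * (2 * m + 1) / (6 * (n + m)) := by
      rw [div_le_div_iff₀ (by positivity) (by positivity)]
      nlinarith [mul_nonneg (show (0:ℝ) ≤ m by linarith) (sub_nonneg.2 h)]
    have h2 := Real.pow_div_factorial_le_exp (x := (m : ℝ) / 6) (by positivity) 3
    have h3 : Real.exp ((m : ℝ) / 6) ≤ Real.exp ((m : ℝ) * (2 * m + 1) / (6 * (n + m))) :=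
      Real.exp_le_exp.2 hz
    rw [Real.exp_neg, ← div_eq_mul_inv, div_le_iff₀ (Real.exp_pos _)]
    have h4 : (m : ℝ) ^ 3 / (n * Real.sqrt n) ≤ m ^ 3 :=
      div_le_self (by positivity) (by nlinarith)
    norm_num [Nat.factorial] at h2
    nlinarith

lemma GG_bound : ∃ C : ℝ, 0 ≤ C ∧ ∀ n m : ℕ, 1 ≤ n → 1 ≤ m →
    (m : ℝ) ^ 3 * GG n m ≤ C ∧ (m : ℝ) ^ 3 * GG n m ≤ C * ((n : ℝ) / m ^ 2) ^ (-(3 : ℝ) / 2) := by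
  obtain ⟨c, hc, ht⟩ := BB_tendsto
  obtain ⟨B, hB⟩ := ht.bddAbove_range
  have hB' : ∀ n : ℕ, Real.sqrt n * BB n ≤ B := fun n => hB ⟨n, rfl⟩
  have hB0 : 0 ≤ B := le_trans (by have := BB_nonneg 0; positivity) (hB' 0)
  refine ⟨1296 * B, by positivity, fun n m hn hm => ?_⟩
  have hn' : (1 : ℝ) ≤ n := by exact_mod_cast hn
  have hm' : (1 : ℝ) ≤ m := by exact_mod_cast hm
  have hr : (n : ℝ) ^ 2 / ((2 * n + 2 * m + 1) * (2 * n + 2 * m + 2)) ≤ 1 := by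
    rw [div_le_one (by positivity)]; nlinarith
  have hr0 : 0 ≤ (n : ℝ) ^ 2 / ((2 * n + 2 * m + 1) * (2 * n + 2 * m + 2)) := by positivity
  have hP := PP_le n m hn
  have hP0 := PP_nonneg n (2 * m)
  have hc := crude n m hn hm
  have hq0 : 0 ≤ ((n : ℝ) / m ^ 2) ^ (-(3 : ℝ) / 2) := by positivity
  rw [← q_rpow n m hn hm] at hc
  rw [GG_eq n m hn hm]
  have hE1 : Real.exp (-((m : ℝ) * (2 * m + 1) / (6 * (n + m)))) ≤ 1 := by
    rw [Real.exp_le_one_iff]; rw [neg_nonpos]; positivity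
  have hb0 : 0 ≤ Real.sqrt n * BB n := by have := BB_nonneg n; positivity
  have key : ((n : ℝ) / m ^ 2) ^ (-(3 : ℝ) / 2) *
      ((n : ℝ) ^ 2 / ((2 * n + 2 * m + 1) * (2 * n + 2 * m + 2))) * (Real.sqrt n * BB n) *
        PP n (2 * m) ≤ ((n : ℝ) / m ^ 2) ^ (-(3 : ℝ) / 2) * 1 * B *
          Real.exp (-((m : ℝ) * (2 * m + 1) / (6 * (n + m)))) := by
    gcongr
    exact hB' n
  constructor
  · refine key.trans ?_
    nlinarith
  · refine key.trans ?_
    have : ((n : ℝ) / m ^ 2) ^ (-(3 : ℝ) / 2) * 1 * B *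
          Real.exp (-((m : ℝ) * (2 * m + 1) / (6 * (n + m)))) ≤ ((n : ℝ) / m ^ 2) ^ (-(3 : ℝ) / 2) * 1 * B * 1 := by gcongr
    have h0 := mul_nonneg hq0 hB0
    nlinarith

lemma total_integral : ∫ x in Set.Ioi (0 : ℝ), x ^ (-(3 : ℝ) / 2) * Real.exp (-1 / (3 * x)) =
    Real.sqrt (3 * Real.pi) := by
  have h := integral_comp_rpow_Ioi (fun y : ℝ => Real.exp (-(1 / 3) * y ^ 2)) (p := -(1 / 2)) (by norm_num)
  rw [integral_gaussian_Ioi] at h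
  have h2 : ∫ x in Set.Ioi (0 : ℝ), (|(-(1 / 2) : ℝ)| * x ^ (-(1 / 2) - 1 : ℝ)) •
      Real.exp (-(1 / 3) * (x ^ (-(1 / 2) : ℝ)) ^ 2) =
      ∫ x in Set.Ioi (0 : ℝ), (1 / 2) * (x ^ (-(3 : ℝ) / 2) * Real.exp (-1 / (3 * x))) := by
    refine setIntegral_congr_fun measurableSet_Ioi (fun x hx => ?_)
    have hx' : (0 : ℝ) < x := hx
    have e : (x ^ (-(1 / 2) : ℝ)) ^ 2 = x⁻¹ := by
      rw [← Real.rpow_natCast, ← Real.rpow_mul hx'.le]; norm_num [Real.rpow_neg_one]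
    simp only [smul_eq_mul]
    rw [e, abs_neg, abs_of_pos (by norm_num), show (-(1 / 2) - 1 : ℝ) = -3 / 2 by norm_num,
      show -(1 / 3) * x⁻¹ = -1 / (3 * x) by field_simp]
    ring
  rw [h2, integral_const_mul] at h
  have e3 : Real.pi / (1 / 3) = 3 * Real.pi := by ring
  rw [e3] at h
  linarith

lemma ceil_ratio (x : ℝ) (hx : 0 < x) :
    Tendsto (fun m : ℕ => ((⌈x * (m : ℝ) ^ 2⌉₊ : ℕ) : ℝ) / (m : ℝ) ^ 2) atTop (𝓝 x) := by
  have h := (tendsto_nat_ceil_mul_div_atTop (R := ℝ) hx.le)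
  have h2 : Tendsto (fun m : ℕ => (m : ℝ) ^ 2) atTop atTop :=
    (tendsto_pow_atTop (by norm_num)).comp tendsto_natCast_atTop_atTop
  exact h.comp h2

lemma pointwise_limit (c : ℝ) (hc : Tendsto (fun n : ℕ => Real.sqrt n * BB n) atTop (𝓝 c))
    (x : ℝ) (hx : 0 < x) :
    Tendsto (fun m : ℕ => (m : ℝ) ^ 3 * GG ⌈x * (m : ℝ) ^ 2⌉₊ m) atTop
      (𝓝 (c / 4 * (x ^ (-(3 : ℝ) / 2) * Real.exp (-1 / (3 * x))))) := by
  set N : ℕ → ℕ := fun m => ⌈x * (m : ℝ) ^ 2⌉₊ with hN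
  have hr : Tendsto (fun m : ℕ => (N m : ℝ) / (m : ℝ) ^ 2) atTop (𝓝 x) := ceil_ratio x hx
  have hpos : ∀ᶠ m : ℕ in atTop, 1 ≤ m ∧ 1 ≤ N m := by
    filter_upwards [eventually_ge_atTop 1] with m hm
    have hm' : (0 : ℝ) < m := by exact_mod_cast hm
    exact ⟨hm, Nat.ceil_pos.2 (by positivity)⟩
  have hinv : Tendsto (fun m : ℕ => 1 / (m : ℝ)) atTop (𝓝 0) := tendsto_one_div_atTop_nhds_zero_nat
  have hNtop : Tendsto N atTop atTop := by
    have h2 : Tendsto (fun m : ℕ => x * (m : ℝ) ^ 2) atTop atTop :=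
      ((tendsto_pow_atTop (by norm_num)).comp tendsto_natCast_atTop_atTop).const_mul_atTop hx
    exact tendsto_nat_ceil_atTop.comp h2
  have h1 : Tendsto (fun m : ℕ => ((N m : ℝ) / (m : ℝ) ^ 2) ^ (-(3 : ℝ) / 2)) atTop
      (𝓝 (x ^ (-(3 : ℝ) / 2))) := hr.rpow_const (Or.inl hx.ne')
  have h2 : Tendsto (fun m : ℕ => (N m : ℝ) ^ 2 / ((2 * N m + 2 * m + 1) * (2 * N m + 2 * m + 2)))
      atTop (𝓝 (1 / 4)) := by
    have : Tendsto (fun m : ℕ => ((N m : ℝ) / (m : ℝ) ^ 2) ^ 2 /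
        ((2 * ((N m : ℝ) / (m : ℝ) ^ 2) + 2 * (1 / (m : ℝ)) + (1 / (m : ℝ)) ^ 2) *
          (2 * ((N m : ℝ) / (m : ℝ) ^ 2) + 2 * (1 / (m : ℝ)) + 2 * (1 / (m : ℝ)) ^ 2))) atTop
        (𝓝 (x ^ 2 / ((2 * x + 2 * 0 + 0 ^ 2) * (2 * x + 2 * 0 + 2 * 0 ^ 2)))) := by
      refine (hr.pow 2).div ((((hr.const_mul 2).add (hinv.const_mul 2)).add (hinv.pow 2)).mul
        (((hr.const_mul 2).add (hinv.const_mul 2)).add ((hinv.pow 2).const_mul 2))) ?_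
      simp [hx.ne']
    have e : x ^ 2 / ((2 * x + 2 * 0 + 0 ^ 2) * (2 * x + 2 * 0 + 2 * 0 ^ 2)) = 1 / 4 := by
      field_simp; ring
    rw [e] at this
    refine this.congr' ?_
    filter_upwards [hpos] with m hm
    have hm' : (0 : ℝ) < m := by exact_mod_cast hm.1
    field_simp
  have h3 : Tendsto (fun m : ℕ => Real.sqrt (N m) * BB (N m)) atTop (𝓝 c) := hc.comp hNtop
  have h4 : Tendsto (fun m : ℕ => PP (N m) (2 * m)) atTop (𝓝 (Real.exp (-1 / (3 * x)))) := by
    have e : -1 / (3 * x) = -((2 + 0) / (6 * x)) := by field_simp; norm_num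
    have e' : -1 / (3 * x) = -((2 + 0) / (6 * (x + 0))) := by rw [add_zero x, e]
    have hl : Tendsto (fun m : ℕ => Real.exp (-((m : ℝ) * (2 * m + 1) / (6 * N m)))) atTop
        (𝓝 (Real.exp (-1 / (3 * x)))) := by
      rw [e]
      have : Tendsto (fun m : ℕ => Real.exp (-((2 + 1 / (m : ℝ)) / (6 * ((N m : ℝ) / (m : ℝ) ^ 2)))))
          atTop (𝓝 (Real.exp (-((2 + 0) / (6 * x))))) := by
        refine (Real.continuous_exp.tendsto _).comp
          ((((tendsto_const_nhds).add hinv).div (hr.const_mul 6) (by positivity)).neg)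
      refine this.congr' ?_
      filter_upwards [hpos] with m hm
      have hm' : (0 : ℝ) < m := by exact_mod_cast hm.1
      have hN' : (0 : ℝ) < N m := by exact_mod_cast hm.2
      congr 2
      field_simp
    have hu : Tendsto (fun m : ℕ => Real.exp (-((m : ℝ) * (2 * m + 1) / (6 * (N m + m))))) atTop
        (𝓝 (Real.exp (-1 / (3 * x)))) := by
      rw [e']
      have : Tendsto (fun m : ℕ => Real.exp (-((2 + 1 / (m : ℝ)) /
          (6 * ((N m : ℝ) / (m : ℝ) ^ 2 + 1 / (m : ℝ))))))
          atTop (𝓝 (Real.exp (-((2 + 0) / (6 * (x + 0)))))) := by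
        refine (Real.continuous_exp.tendsto _).comp
          ((((tendsto_const_nhds).add hinv).div ((hr.add hinv).const_mul 6) (by positivity)).neg)
      refine this.congr' ?_
      filter_upwards [hpos] with m hm
      have hm' : (0 : ℝ) < m := by exact_mod_cast hm.1
      have hN' : (0 : ℝ) < N m := by exact_mod_cast hm.2
      congr 2
      field_simp
    refine tendsto_of_tendsto_of_tendsto_of_le_of_le' hl hu ?_ ?_
    · filter_upwards [hpos] with m hm using le_PP _ _ hm.2
    · filter_upwards [hpos] with m hm using PP_le _ _ hm.2
  have h := ((h1.mul h2).mul h3).mul h4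
  rw [show c / 4 * (x ^ (-(3 : ℝ) / 2) * Real.exp (-1 / (3 * x))) =
    x ^ (-(3 : ℝ) / 2) * (1 / 4) * c * Real.exp (-1 / (3 * x)) by ring]
  refine h.congr' ?_
  filter_upwards [hpos] with m hm
  rw [GG_eq _ _ hm.2 hm.1]

/-- The rescaled step function. -/
noncomputable def FF (t : ℝ) (m : ℕ) (x : ℝ) : ℝ :=
  if t * (m : ℝ) ^ 2 < (⌈x * (m : ℝ) ^ 2⌉₊ : ℝ) then (m : ℝ) ^ 3 * GG ⌈x * (m : ℝ) ^ 2⌉₊ m else 0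

lemma FF_measurable (t : ℝ) (m : ℕ) : Measurable (FF t m) := by
  have h : Measurable (fun n : ℕ => if t * (m : ℝ) ^ 2 < (n : ℝ) then (m : ℝ) ^ 3 * GG n m else 0) :=
    measurable_from_top
  exact h.comp (Nat.measurable_ceil.comp (measurable_id.mul_const _))

/-- The dominating function. -/
noncomputable def DD (C x : ℝ) : ℝ := if x ≤ 1 then C else C * x ^ (-(3 : ℝ) / 2)

lemma DD_integrable (C : ℝ) : IntegrableOn (DD C) (Set.Ioi 0) := by
  rw [← Set.Ioc_union_Ioi_eq_Ioi (zero_le_one' ℝ)]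
  refine IntegrableOn.union ?_ ?_
  · refine IntegrableOn.congr_fun (f := fun _ => C) (by simp) (fun x hx => ?_) measurableSet_Ioc
    simp [DD, hx.2]
  · refine IntegrableOn.congr_fun (f := fun x => C * x ^ (-(3 : ℝ) / 2))
      ((integrableOn_Ioi_rpow_of_lt (by norm_num) one_pos).const_mul C) (fun x hx => ?_)
      measurableSet_Ioi
    have : ¬ x ≤ 1 := not_le.2 hx
    simp [DD, this]

lemma FF_bound : ∃ C : ℝ, ∀ (t : ℝ) (m : ℕ), 1 ≤ m → ∀ x : ℝ, 0 < x → ‖FF t m x‖ ≤ DD C x := by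
  obtain ⟨C, hC, h⟩ := GG_bound
  refine ⟨C, fun t m hm x hx => ?_⟩
  have hm' : (0 : ℝ) < m := by exact_mod_cast hm
  have hn : 1 ≤ ⌈x * (m : ℝ) ^ 2⌉₊ := Nat.ceil_pos.2 (by positivity)
  obtain ⟨h1, h2⟩ := h _ m hn hm
  have hG := GG_nonneg ⌈x * (m : ℝ) ^ 2⌉₊ m
  have hle : ‖FF t m x‖ ≤ (m : ℝ) ^ 3 * GG ⌈x * (m : ℝ) ^ 2⌉₊ m := by
    unfold FF
    split_ifs
    · rw [Real.norm_of_nonneg (by positivity)]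
    · simp; positivity
  refine hle.trans ?_
  unfold DD
  split_ifs
  · exact h1
  · refine h2.trans ?_
    refine mul_le_mul_of_nonneg_left ?_ hC
    refine Real.rpow_le_rpow_of_nonpos hx ?_ (by norm_num)
    rw [le_div_iff₀ (by positivity)]
    exact Nat.le_ceil _

lemma FF_integrable (t : ℝ) (m : ℕ) (hm : 1 ≤ m) : IntegrableOn (FF t m) (Set.Ioi 0) := by
  obtain ⟨C, hC⟩ := FF_bound
  refine Integrable.mono' (DD_integrable C) (FF_measurable t m).aestronglyMeasurable ?_
  filter_upwards [ae_restrict_mem measurableSet_Ioi] with x hx using hC t m hm x hx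

lemma FF_hasSum (t : ℝ) (ht : 0 ≤ t) (m : ℕ) (hm : 1 ≤ m) :
    HasSum (fun n : ℕ => (m : ℝ) * (if t * (m : ℝ) ^ 2 < (n : ℝ) then GG n m else 0))
      (∫ x in Set.Ioi 0, FF t m x) := by
  have hm' : (0 : ℝ) < m := by exact_mod_cast hm
  set s : ℕ → Set ℝ := fun n => Set.Ioc ((n : ℝ) / (m : ℝ) ^ 2) (((n : ℝ) + 1) / (m : ℝ) ^ 2) with hs
  have hmem : ∀ n x, x ∈ s n ↔ ⌈x * (m : ℝ) ^ 2⌉₊ = n + 1 := by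
    intro n x
    rw [Nat.ceil_eq_iff (Nat.succ_ne_zero n)]
    simp only [hs, Set.mem_Ioc]
    rw [div_lt_iff₀ (by positivity), le_div_iff₀ (by positivity)]
    simp
  have hU : (⋃ n, s n) = Set.Ioi 0 := by
    ext x
    simp only [Set.mem_iUnion, hmem, Set.mem_Ioi]
    constructor
    · rintro ⟨n, hn⟩
      have : 0 < ⌈x * (m : ℝ) ^ 2⌉₊ := by omega
      have := Nat.ceil_pos.1 this
      exact (pos_iff_pos_of_mul_pos this).2 (by positivity)
    · intro hx
      have : 0 < ⌈x * (m : ℝ) ^ 2⌉₊ := Nat.ceil_pos.2 (by positivity)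
      exact ⟨⌈x * (m : ℝ) ^ 2⌉₊ - 1, by omega⟩
  have h := hasSum_integral_iUnion (μ := volume) (f := FF t m) (s := s) (fun n => measurableSet_Ioc)
    (by
      intro i j hij
      refine Set.disjoint_left.2 (fun x hi hj => hij ?_)
      rw [hmem] at hi hj
      omega)
    (by rw [hU]; exact FF_integrable t m hm)
  rw [hU] at h
  have hterm : ∀ n, ∫ x in s n, FF t m x =
      (m : ℝ) * (if t * (m : ℝ) ^ 2 < ((n + 1 : ℕ) : ℝ) then GG (n + 1) m else 0) := by
    intro n
    have : ∫ x in s n, FF t m x = ∫ x in s n,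
        (if t * (m : ℝ) ^ 2 < ((n + 1 : ℕ) : ℝ) then (m : ℝ) ^ 3 * GG (n + 1) m else 0) := by
      refine setIntegral_congr_fun measurableSet_Ioc (fun x hx => ?_)
      have := (hmem n x).1 hx
      simp only [FF, this]
    rw [this, setIntegral_const]
    simp only [hs, Real.volume_real_Ioc, smul_eq_mul]
    rw [max_eq_left (by rw [← sub_div]; simp)]
    split_ifs
    · field_simp
      try ring
    · simp
  simp_rw [hterm] at h
  have h' := (hasSum_nat_add_iff (f := fun n : ℕ => (m : ℝ) * (if t * (m : ℝ) ^ 2 < (n : ℝ) then GG n m else 0)) 1).1 h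
  have h0 : ¬ (t * (m : ℝ) ^ 2 < 0) := not_lt.2 (by positivity)
  simpa [h0] using h'

lemma main_limit (c : ℝ) (hc : Tendsto (fun n : ℕ => Real.sqrt n * BB n) atTop (𝓝 c))
    (t : ℝ) (ht : 0 ≤ t) :
    Tendsto (fun m : ℕ => (m : ℝ) * ∑' n : ℕ, (if t * (m : ℝ) ^ 2 < (n : ℝ) then GG n m else 0)) atTop
      (𝓝 (c / 4 * ∫ x in Set.Ioi t, x ^ (-(3 : ℝ) / 2) * Real.exp (-1 / (3 * x)))) := by
  obtain ⟨C, hC⟩ := FF_bound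
  have hlim : Tendsto (fun m : ℕ => ∫ x in Set.Ioi 0, FF t m x) atTop
      (𝓝 (∫ x in Set.Ioi 0, (Set.Ioi t).indicator
        (fun x => c / 4 * (x ^ (-(3 : ℝ) / 2) * Real.exp (-1 / (3 * x)))) x)) := by
    refine tendsto_integral_filter_of_dominated_convergence (DD C) ?_ ?_ (DD_integrable C) ?_
    · exact Eventually.of_forall fun m => (FF_measurable t m).aestronglyMeasurable
    · filter_upwards [eventually_ge_atTop 1] with m hm
      filter_upwards [ae_restrict_mem measurableSet_Ioi] with x hx using hC t m hm x hx
    · have hne : ∀ᵐ x ∂(volume.restrict (Set.Ioi (0 : ℝ))), x ≠ t :=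
        ae_restrict_of_ae (Measure.ae_ne volume t)
      filter_upwards [ae_restrict_mem measurableSet_Ioi, hne] with x hx hxt
      rcases lt_or_gt_of_ne hxt with h | h
      · rw [Set.indicator_of_notMem (by simpa using h.le)]
        refine tendsto_const_nhds.congr' ?_
        filter_upwards [(ceil_ratio x hx).eventually_lt_const h, eventually_ge_atTop 1] with m hm h1
        have hm' : (0 : ℝ) < m := by exact_mod_cast h1
        rw [div_lt_iff₀ (by positivity)] at hm
        rw [FF, if_neg (not_lt.2 hm.le)]
      · rw [Set.indicator_of_mem (by simpa using h)]
        refine (pointwise_limit c hc x hx).congr' ?_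
        filter_upwards [eventually_ge_atTop 1] with m h1
        have hm' : (0 : ℝ) < m := by exact_mod_cast h1
        rw [FF, if_pos]
        refine lt_of_lt_of_le ?_ (Nat.le_ceil _)
        gcongr
  rw [setIntegral_indicator measurableSet_Ioi, Set.Ioi_inter_Ioi, sup_eq_right.2 ht,
    integral_const_mul] at hlim
  refine hlim.congr' ?_
  filter_upwards [eventually_ge_atTop 1] with m hm
  rw [← (FF_hasSum t ht m hm).tsum_eq, tsum_mul_left]

theorem marked_size_stable_limit (t : ℝ) (ht : 0 < t) :
    Tendsto
      (fun m : ℕ =>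
        (∑' n : ℕ, if t * (m : ℝ) ^ 2 < (n : ℝ) then (n : ℝ) * phi n m * (2 / 27) ^ n else 0) /
          Ztilde m)
      atTop
      (nhds ((1 / Real.sqrt (3 * Real.pi)) *
        ∫ x in Set.Ioi t, x ^ (-(3 : ℝ) / 2) * Real.exp (-1 / (3 * x)))) := by
  obtain ⟨c, hc0, hc⟩ := BB_tendsto
  have h1 := main_limit c hc t ht.le
  have h2 := main_limit c hc 0 le_rfl
  rw [total_integral] at h2
  have hpi : 0 < Real.sqrt (3 * Real.pi) := Real.sqrt_pos.2 (by positivity)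
  have h := h1.div h2 (by positivity)
  rw [show ∀ I : ℝ, c / 4 * I / (c / 4 * Real.sqrt (3 * Real.pi)) =
    1 / Real.sqrt (3 * Real.pi) * I by intro I; field_simp] at h
  refine h.congr' ?_
  filter_upwards [eventually_ge_atTop 1] with m hm
  have hm' : (0 : ℝ) < m := by exact_mod_cast hm
  have hA := AA_pos m
  have e1 : (∑' n : ℕ, if t * (m : ℝ) ^ 2 < (n : ℝ) then (n : ℝ) * phi n m * (2 / 27) ^ n else 0) =
      AA m * ∑' n : ℕ, (if t * (m : ℝ) ^ 2 < (n : ℝ) then GG n m else 0) := by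
    rw [← tsum_mul_left]
    refine tsum_congr fun n => ?_
    rw [term_eq, mul_ite, mul_zero]
  have e2 : Ztilde m = AA m * ∑' n : ℕ, (if 0 * (m : ℝ) ^ 2 < (n : ℝ) then GG n m else 0) := by
    rw [← tsum_mul_left]
    refine tsum_congr fun n => ?_
    rw [term_eq]
    split_ifs with hh
    · rfl
    · have : n = 0 := by
        by_contra hne
        exact hh (by rw [zero_mul]; exact_mod_cast Nat.pos_of_ne_zero hne)
      subst this
      simp [GG]
  rw [e1, e2]
  simp only [Pi.div_apply]
  rw [mul_div_mul_left _ _ hm'.ne', mul_div_mul_left _ _ hA.ne']
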